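/- For every integer k ≥ 2 there exists an instance (G, L) of MLCM-P with |L| = k lines such that for every proper subset L' ⊊ L the instance (G, L') admits a crossing-free solution, while (G, L) itself admits no crossing-free solution (every solution has at least one crossing). -/

import Mathlib

/-!
Core model for metro-line crossing minimization (MLCM).

An embedded graph is a symmetric loopless graph together with, for each
vertex, a list of its neighbours in clockwise order (the embedding).
A line is a simple path in the graph.  A line layout assigns to each
ordered pair `(u, v)` forming an edge the clockwise order `ord u v` in
which the lines through `{u, v}` meet the port of `u`.
-/

structure EmbeddedGraph (V : Type) where
  adj : V → V → Prop
  symm : ∀ {u v}, adj u v → adj v u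
  loopless : ∀ v, ¬ adj v v
  rot : V → List V
  rot_mem : ∀ u v, v ∈ rot u ↔ adj u v
  rot_nodup : ∀ u, (rot u).Nodup

/-- `p` is a simple path (with at least one edge) in `G`. -/
def EmbeddedGraph.IsPath {V : Type} (G : EmbeddedGraph V) (p : List V) : Prop :=
  p.Nodup ∧ 2 ≤ p.length ∧ p.Chain' G.adj

/-- An instance of MLCM: an embedded graph together with a set of lines
(indexed by `ι`), each a simple path. -/
structure MLCMInstance (V ι : Type) where
  G : EmbeddedGraph V
  line : ι → List V
  line_path : ∀ i, G.IsPath (line i)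

namespace MLCMInstance

variable {V ι : Type}

/-- Line `i` passes through the edge `{u, v}`. -/
def usesEdge (M : MLCMInstance V ι) (i : ι) (u v : V) : Prop :=
  [u, v] <:+: M.line i ∨ [v, u] <:+: M.line i

/-- `u` is a terminal (an endpoint) of line `i`. -/
def Terminal (M : MLCMInstance V ι) (i : ι) (u : V) : Prop :=
  (M.line i).head? = some u ∨ (M.line i).getLast? = some u

/-- A line layout: for each ordered pair `(u, v)`, the clockwise order
(at the port of `u`) of the lines through the edge `{u, v}`. -/
structure Layout (M : MLCMInstance V ι) where
  ord : V → V → List ι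
  nodup : ∀ u v, (ord u v).Nodup
  mem_iff : ∀ u v i, i ∈ ord u v ↔ M.usesEdge i u v

variable {M : MLCMInstance V ι}

/-- Lines `i` and `j` have an edge crossing on the edge `{u, v}`:
they appear in the same relative order in both port orders. -/
def EdgeCross (lay : M.Layout) (i j : ι) (u v : V) : Prop :=
  i ≠ j ∧ List.Sublist [i, j] (lay.ord u v) ∧ List.Sublist [i, j] (lay.ord v u)

/-- The cyclic concatenation of the port orders at `u`, following the
clockwise order of the edges incident to `u`. -/
def cyclicAt (lay : M.Layout) (u : V) : List ι :=
  (M.G.rot u).flatMap fun w => lay.ord u w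

/-- Lines `i` and `j` have a vertex crossing at `u`: they alternate
`… i … j … i … j …` in the cyclic concatenation of the port orders. -/
def VertexCross (lay : M.Layout) (i j : ι) (u : V) : Prop :=
  i ≠ j ∧ ∃ n, List.Sublist [i, j, i, j] ((cyclicAt lay u).rotate n)

/-- Lines `i` and `j` cross in the layout. -/
def Crosses (lay : M.Layout) (i j : ι) : Prop :=
  (∃ u v, EdgeCross lay i j u v ∨ EdgeCross lay j i u v) ∨
  (∃ u, VertexCross lay i j u ∨ VertexCross lay j i u)

/-- The pair of lines `i, j` has an unavoidable crossing: the lines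
cross in every line layout. -/
def Unavoidable (M : MLCMInstance V ι) (i j : ι) : Prop :=
  ∀ lay : M.Layout, Crosses lay i j

/-- A vertex crossing of `i, j` at `u` is unavoidable: it occurs in
every line layout. -/
def UnavoidableVC (M : MLCMInstance V ι) (i j : ι) (u : V) : Prop :=
  ∀ lay : M.Layout, VertexCross lay i j u ∨ VertexCross lay j i u

/-- A layout is feasible when it contains no avoidable vertex crossings. -/
def Feasible (lay : M.Layout) : Prop :=
  ∀ i j u, VertexCross lay i j u → M.UnavoidableVC i j u

/-- A layout is crossing-free when no two lines cross in it. -/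
def CrossingFree (lay : M.Layout) : Prop :=
  ∀ i j, i ≠ j → ¬ Crosses lay i j

/-- The periphery condition: at every port the lines terminating at that
vertex occupy the outermost positions of the port order. -/
def Periphery (lay : M.Layout) : Prop :=
  ∀ u v, ∃ s₁ s₂ s₃ : List ι, lay.ord u v = s₁ ++ s₂ ++ s₃ ∧
    (∀ i ∈ s₁, M.Terminal i u) ∧ (∀ i ∈ s₂, ¬ M.Terminal i u) ∧
    (∀ i ∈ s₃, M.Terminal i u)

/-- `P` occurs as a (contiguous) subpath of line `i` (in either direction). -/
def InfixOf (M : MLCMInstance V ι) (i : ι) (P : List V) : Prop :=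
  P <:+: M.line i ∨ P.reverse <:+: M.line i

/-- `P` is a common subpath (with at least one edge) of lines `i` and `j`. -/
def CommonSubpath (M : MLCMInstance V ι) (i j : ι) (P : List V) : Prop :=
  2 ≤ P.length ∧ M.InfixOf i P ∧ M.InfixOf j P

/-- `P` is the (maximal) common subpath of lines `i` and `j`. -/
def MaxCommonSubpath (M : MLCMInstance V ι) (i j : ι) (P : List V) : Prop :=
  M.CommonSubpath i j P ∧ ∀ Q, M.CommonSubpath i j Q → Q.length ≤ P.length

/-- No line is a subpath of another line. -/
def ProperLines (M : MLCMInstance V ι) : Prop :=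
  ∀ i j, i ≠ j → ¬ M.InfixOf j (M.line i)

/-- Relative to the edge directed from `u` to `v`: line `i` is above
line `j` in every crossing-free solution. -/
def MustAbove (M : MLCMInstance V ι) (i j : ι) (u v : V) : Prop :=
  ∀ lay : M.Layout, Feasible lay → CrossingFree lay → List.Sublist [i, j] (lay.ord u v)

/-- `i, j` is an overlapping pair with common subpath `P` from `u` to `v`:
`i` has its terminal at `u`, and `j` has its terminal at `v`. -/
def OverlappingPair (M : MLCMInstance V ι) (i j : ι) (P : List V) (u v : V) : Prop :=
  i ≠ j ∧ M.MaxCommonSubpath i j P ∧ P.head? = some u ∧ P.getLast? = some v ∧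
    M.Terminal i u ∧ M.Terminal j v ∧ ¬ M.Terminal i v ∧ ¬ M.Terminal j u

/-- `l` is a separator of the overlapping pair `i, j` with common subpath `P`:
on `P`, in every crossing-free solution, `l` lies between `i` and `j`. -/
def Separator (M : MLCMInstance V ι) (i j : ι) (P : List V) (l : ι) : Prop :=
  l ≠ i ∧ l ≠ j ∧ ∃ u v, [u, v] <:+: P ∧
    ((M.MustAbove i l u v ∧ M.MustAbove l j u v) ∨
     (M.MustAbove j l u v ∧ M.MustAbove l i u v))

end MLCMInstance

namespace MLCMInstance

variable {V ι : Type}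

/-- The instance obtained by keeping only the lines of the subset `s`. -/
def restrictLines (M : MLCMInstance V ι) (s : Set ι) : MLCMInstance V s :=
  ⟨M.G, fun k => M.line k, fun k => M.line_path k⟩

end MLCMInstance

namespace MLCMInstance

section Lists

variable {α : Type*}

theorem pair_infix_iff_of_pairwise_lt [LinearOrder α] {l : List α} (hl : l.Pairwise (· < ·))
    {u v : α} :
    [u, v] <:+: l ↔ u < v ∧ u ∈ l ∧ v ∈ l ∧ ∀ w ∈ l, u < w → ¬ w < v := by
  constructor
  · rintro ⟨a, b, rfl⟩
    simp only [List.append_assoc, List.cons_append, List.nil_append, List.pairwise_append,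
      List.pairwise_cons, List.mem_cons, forall_eq_or_imp] at hl
    obtain ⟨-, ⟨⟨huv, hub⟩, hvb, -⟩, hab⟩ := hl
    refine ⟨huv, by simp, by simp, ?_⟩
    intro w hw h1 h2
    simp only [List.append_assoc, List.cons_append, List.nil_append, List.mem_append,
      List.mem_cons] at hw
    rcases hw with hw | rfl | rfl | hw
    · exact lt_asymm h1 (hab w hw).1
    · exact lt_irrefl _ h1
    · exact lt_irrefl _ h2
    · exact lt_asymm h2 (hvb w hw)
  · rintro ⟨huv, hu, hv, hw⟩
    obtain ⟨a, b, rfl⟩ := List.append_of_mem hu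
    simp only [List.pairwise_append, List.pairwise_cons, List.mem_cons, forall_eq_or_imp] at hl
    obtain ⟨-, ⟨hub, hb⟩, hab⟩ := hl
    have hvb : v ∈ b := by
      simp only [List.mem_append, List.mem_cons] at hv
      rcases hv with hv | rfl | hv
      · exact absurd (hab v hv).1 (lt_asymm huv)
      · exact absurd huv (lt_irrefl _)
      · exact hv
    obtain ⟨c, d, rfl⟩ := List.append_of_mem hvb
    cases c with
    | nil => exact ⟨a, d, by simp⟩
    | cons x c =>
      exfalso
      simp only [List.cons_append, List.pairwise_cons] at hb
      exact hw x (by simp) (hub x (by simp)) (hb.1 v (by simp))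

theorem head?_eq_some_iff_of_pairwise_lt [LinearOrder α] {l : List α}
    (hl : l.Pairwise (· < ·)) {u : α} :
    l.head? = some u ↔ u ∈ l ∧ ∀ w ∈ l, u ≤ w := by
  cases l with
  | nil => simp
  | cons x l =>
    simp only [List.pairwise_cons] at hl
    simp only [List.head?_cons, Option.some.injEq, List.mem_cons, forall_eq_or_imp]
    constructor
    · rintro rfl
      exact ⟨Or.inl rfl, le_rfl, fun w hw => (hl.1 w hw).le⟩
    · rintro ⟨rfl | h, h', -⟩
      · rfl
      · exact absurd (hl.1 u h) (not_lt.2 h')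

theorem getLast?_eq_some_iff_of_pairwise_lt [LinearOrder α] {l : List α}
    (hl : l.Pairwise (· < ·)) {u : α} :
    l.getLast? = some u ↔ u ∈ l ∧ ∀ w ∈ l, w ≤ u := by
  rw [← List.head?_reverse]
  exact (head?_eq_some_iff_of_pairwise_lt (α := αᵒᵈ) (l := l.reverse)
    (List.pairwise_reverse.2 hl)).trans (and_congr List.mem_reverse (forall_congr' fun w =>
      imp_congr List.mem_reverse Iff.rfl))

theorem exists_mem_outermost_split (T : α → Prop) (l : List α)
    (h : ∀ a t b, [a, t, b].Sublist l → T t → T a ∨ T b) :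
    ∃ s₁ s₂ s₃ : List α, l = s₁ ++ s₂ ++ s₃ ∧
      (∀ i ∈ s₁, T i) ∧ (∀ i ∈ s₂, ¬ T i) ∧ (∀ i ∈ s₃, T i) := by
  classical
  have key : ∀ (l : List α), (∀ t b, [t, b].Sublist l → T t → T b) →
      ∃ s₂ s₃ : List α, l = s₂ ++ s₃ ∧ (∀ i ∈ s₂, ¬ T i) ∧ (∀ i ∈ s₃, T i) := by
    intro l
    induction l with
    | nil => intro _; exact ⟨[], [], by simp⟩
    | cons x l ih =>
      intro h
      by_cases hx : T x
      · refine ⟨[], x :: l, by simp, by simp, ?_⟩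
        simp only [List.mem_cons, forall_eq_or_imp]
        exact ⟨hx, fun y hy => h x y (by simpa using hy) hx⟩
      · obtain ⟨s₂, s₃, rfl, h2, h3⟩ := ih fun t b ht => h t b (ht.cons _)
        exact ⟨x :: s₂, s₃, by simp, by simpa using ⟨hx, h2⟩, h3⟩
  induction l with
  | nil => exact ⟨[], [], [], by simp⟩
  | cons x l ih =>
    by_cases hx : T x
    · obtain ⟨s₁, s₂, s₃, rfl, h1, h2, h3⟩ := ih fun a t b ht => h a t b (ht.cons _)
      exact ⟨x :: s₁, s₂, s₃, by simp, by simpa using ⟨hx, h1⟩, h2, h3⟩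
    · obtain ⟨s₂, s₃, rfl, h2, h3⟩ := key l fun t b ht hT =>
        (h x t b (ht.cons_cons _) hT).resolve_left hx
      exact ⟨[], x :: s₂, s₃, by simp, by simp, by simpa using ⟨hx, h2⟩, h3⟩

theorem alternating_sublist_of_sublist_rotate {i j : α} {l : List α} {n : ℕ}
    (h : [i, j, i, j].Sublist (l.rotate n)) :
    [i, j, i, j].Sublist l ∨ [j, i, j, i].Sublist l := by
  rw [List.rotate_eq_drop_append_take_mod, List.sublist_append_iff] at h
  obtain ⟨a, b, hab, ha, hb⟩ := h
  have key : (b ++ a).Sublist l := by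
    have := hb.append ha
    rwa [List.take_append_drop] at this
  rcases a with _ | ⟨a1, _ | ⟨a2, _ | ⟨a3, _ | ⟨a4, _ | ⟨a5, a⟩⟩⟩⟩⟩ <;>
    simp only [List.nil_append, List.cons_append, List.cons.injEq, List.nil_eq] at hab
  · subst hab; exact Or.inl (by simpa using key)
  · obtain ⟨rfl, rfl⟩ := hab; exact Or.inr key
  · obtain ⟨rfl, rfl, rfl⟩ := hab; exact Or.inl key
  · obtain ⟨rfl, rfl, rfl, rfl⟩ := hab; exact Or.inr key
  · obtain ⟨rfl, rfl, rfl, rfl, rfl⟩ := hab; exact Or.inl key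
  · simp at hab

theorem eq_or_sublist_pair {l : List α} {a b : α} (ha : a ∈ l) (hb : b ∈ l) :
    a = b ∨ [a, b].Sublist l ∨ [b, a].Sublist l := by
  obtain ⟨s, t, rfl⟩ := List.append_of_mem ha
  simp only [List.mem_append, List.mem_cons] at hb
  rcases hb with hb | rfl | hb
  · refine Or.inr (Or.inr ?_)
    have : ([b] ++ [a]).Sublist (s ++ a :: t) :=
      (List.singleton_sublist.2 hb).append (by simp)
    simpa using this
  · exact Or.inl rfl
  · exact Or.inr (Or.inl (((List.singleton_sublist.2 hb).cons_cons a).trans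
      (List.sublist_append_right _ _)))

theorem not_sublist_swap_of_nodup {l : List α} (hl : l.Nodup) {a b : α}
    (hab : [a, b].Sublist l) : ¬ [b, a].Sublist l := by
  induction l with
  | nil => simp at hab
  | cons x l ih =>
    rw [List.nodup_cons] at hl
    intro hba
    rcases List.sublist_cons_iff.1 hab with h1 | ⟨r, h1, hr⟩ <;>
      rcases List.sublist_cons_iff.1 hba with h2 | ⟨r', h2, hr'⟩
    · exact ih hl.2 h1 h2
    · obtain ⟨rfl, rfl⟩ := List.cons.inj h2
      exact hl.1 (h1.subset (by simp))
    · obtain ⟨rfl, rfl⟩ := List.cons.inj h1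
      exact hl.1 (h2.subset (by simp))
    · obtain ⟨rfl, rfl⟩ := List.cons.inj h1
      exact hl.1 (hr.subset (by simp [(List.cons.inj h2).1]))

theorem sublist_flatMap_of_pairwise_lt [LinearOrder α] {β : Type*} {l r : List α}
    (hl : l.Pairwise (· < ·)) (hr : r.Pairwise (· < ·)) (h : l ⊆ r) (f : α → List β) :
    (l.flatMap f).Sublist (r.flatMap f) := by
  have hsub : l.Sublist r := by
    have hln : l.Nodup := hl.imp (fun h => ne_of_lt h)
    exact List.sublist_of_subperm_of_pairwise (hln.subperm h)
      hl hr
  exact hsub.flatMap f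

end Lists

/-- The lines `{v | p i v}`, each traversed in increasing order, in the complete graph on `Fin n`
whose rotation at every vertex lists the neighbours in increasing order. -/
def monotoneInstance {n : ℕ} {ι : Type} (p : ι → Fin n → Bool)
    (hp : ∀ i, 2 ≤ ((List.finRange n).filter (p i)).length) : MLCMInstance (Fin n) ι where
  G :=
    { adj := fun u v => u ≠ v
      symm := Ne.symm
      loopless := fun v h => h rfl
      rot := fun u => (List.finRange n).filter fun v => decide (u ≠ v)
      rot_mem := by simp
      rot_nodup := fun u => (List.nodup_finRange n).filter _ }
  line := fun i => (List.finRange n).filter (p i)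
  line_path := fun i => by
    have h := (List.nodup_finRange n).filter (p i)
    exact ⟨h, hp i, List.Pairwise.isChain h⟩

section Monotone

variable {n : ℕ} {ι : Type} {p : ι → Fin n → Bool}
  {hp : ∀ i, 2 ≤ ((List.finRange n).filter (p i)).length}

theorem pairwise_lt_filter_finRange (q : Fin n → Bool) :
    ((List.finRange n).filter q).Pairwise (· < ·) :=
  (List.pairwise_lt_finRange n).filter q

theorem monotoneInstance_usesEdge_of_lt {i : ι} {u v : Fin n} (huv : u < v) :
    (monotoneInstance p hp).usesEdge i u v ↔
      p i u ∧ p i v ∧ ∀ w, p i w → u < w → ¬ w < v := by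
  simp only [usesEdge, monotoneInstance,
    pair_infix_iff_of_pairwise_lt (pairwise_lt_filter_finRange _), List.mem_filter,
    List.mem_finRange, true_and, huv, not_lt_of_gt huv, false_and, or_false]

theorem usesEdge_comm {V : Type} {M : MLCMInstance V ι} {i : ι} {u v : V} :
    M.usesEdge i u v ↔ M.usesEdge i v u := or_comm

theorem monotoneInstance_not_usesEdge_self {i : ι} {u : Fin n} :
    ¬ (monotoneInstance p hp).usesEdge i u u := by
  simp [usesEdge, monotoneInstance, pair_infix_iff_of_pairwise_lt (pairwise_lt_filter_finRange _)]

theorem monotoneInstance_terminal {i : ι} {u : Fin n} :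
    (monotoneInstance p hp).Terminal i u ↔
      p i u ∧ ((∀ w, p i w → u ≤ w) ∨ ∀ w, p i w → w ≤ u) := by
  simp only [Terminal, monotoneInstance,
    head?_eq_some_iff_of_pairwise_lt (pairwise_lt_filter_finRange _),
    getLast?_eq_some_iff_of_pairwise_lt (pairwise_lt_filter_finRange _), List.mem_filter,
    List.mem_finRange, true_and]
  tauto

/-- If a line passes through a vertex at two ports, one of them lies on each side. -/
theorem monotoneInstance_ports_separated {i : ι} {u v w : Fin n} (hvw : v < w)
    (hv : (monotoneInstance p hp).usesEdge i u v) (hw : (monotoneInstance p hp).usesEdge i u w) :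
    v < u ∧ u < w := by
  rcases lt_trichotomy v u with h1 | rfl | h1
  · refine ⟨h1, ?_⟩
    by_contra h2
    rcases lt_or_eq_of_le (not_lt.1 h2) with h2 | rfl
    · rw [usesEdge_comm, monotoneInstance_usesEdge_of_lt h1] at hv
      rw [usesEdge_comm, monotoneInstance_usesEdge_of_lt h2] at hw
      exact hv.2.2 w hw.1 hvw h2
    · exact monotoneInstance_not_usesEdge_self hw
  · exact absurd hv monotoneInstance_not_usesEdge_self
  · rw [monotoneInstance_usesEdge_of_lt h1] at hv
    rw [monotoneInstance_usesEdge_of_lt (h1.trans hvw)] at hw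
    exact absurd hvw (hw.2.2 v hv.2.1 h1)

theorem exists_ports_of_alternating {lay : (monotoneInstance p hp).Layout} {i j : ι} {u : Fin n}
    (h : [i, j, i, j].Sublist (cyclicAt lay u)) :
    ∃ w₁ w₂ w₃ w₄ : Fin n,
      ((w₁ < w₂ ∨ w₁ = w₂ ∧ [i, j].Sublist (lay.ord u w₁)) ∧ w₁ < w₃) ∧
      ((w₃ < w₄ ∨ w₃ = w₄ ∧ [i, j].Sublist (lay.ord u w₃)) ∧ w₂ < w₄) ∧
      i ∈ lay.ord u w₁ ∧ j ∈ lay.ord u w₂ ∧ i ∈ lay.ord u w₃ ∧ j ∈ lay.ord u w₄ := by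
  set R := ((monotoneInstance p hp).G.rot u).flatMap fun w => (lay.ord u w).map fun i => (w, i)
    with hR
  have hmap : cyclicAt lay u = R.map Prod.snd := by
    simp [cyclicAt, hR, List.map_flatMap, Function.comp_def]
  have hmem : ∀ x ∈ R, x.2 ∈ lay.ord u x.1 := by
    rintro ⟨w, i⟩ hx
    simp only [hR, List.mem_flatMap, List.mem_map, Prod.mk.injEq] at hx
    obtain ⟨w', -, i', hi, rfl, rfl⟩ := hx
    exact hi
  have hpw : R.Pairwise fun x y => x.1 < y.1 ∨ x.1 = y.1 ∧ [x.2, y.2].Sublist (lay.ord u x.1) := by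
    rw [hR, List.pairwise_flatMap]
    constructor
    · intro w _
      rw [List.pairwise_map, List.pairwise_iff_forall_sublist]
      intro a b hab
      exact Or.inr ⟨rfl, hab⟩
    · refine (pairwise_lt_filter_finRange _).imp ?_
      intro a b hab x hx y hy
      simp only [List.mem_map] at hx hy
      obtain ⟨_, _, rfl⟩ := hx
      obtain ⟨_, _, rfl⟩ := hy
      exact Or.inl hab
  rw [hmap, List.sublist_map_iff] at h
  obtain ⟨l, hl, heq⟩ := h
  rcases l with _ | ⟨⟨w1, a1⟩, _ | ⟨⟨w2, a2⟩, _ | ⟨⟨w3, a3⟩, _ | ⟨⟨w4, a4⟩, _ | ⟨⟨w5, a5⟩, l⟩⟩⟩⟩⟩ <;>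
    simp at heq
  obtain ⟨rfl, rfl, rfl, rfl⟩ := heq
  have hpl := hpw.sublist hl
  simp only [List.pairwise_cons, List.mem_cons, forall_eq_or_imp, List.not_mem_nil,
    or_false, forall_eq] at hpl
  obtain ⟨⟨h12, h13, -⟩, ⟨-, h24⟩, h34, -⟩ := hpl
  have hne : ∀ (a : ι) (w : Fin n), ¬ [a, a].Sublist (lay.ord u w) := fun a w h => by
    simpa using (lay.nodup u w).sublist h
  exact ⟨w1, w2, w3, w4, ⟨h12, h13.resolve_right fun h => hne _ _ h.2⟩,
    ⟨h34, h24.resolve_right fun h => hne _ _ h.2⟩, hmem (w1, i) (hl.subset (by simp)),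
    hmem (w2, j) (hl.subset (by simp)), hmem (w3, i) (hl.subset (by simp)),
    hmem (w4, j) (hl.subset (by simp))⟩

theorem crossingFree_of_height {lay : (monotoneInstance p hp).Layout} (h : ι → ℤ)
    (hlt : ∀ u v i j, u < v → [i, j].Sublist (lay.ord u v) → h j < h i)
    (hgt : ∀ u v i j, v < u → [i, j].Sublist (lay.ord u v) → h i < h j)
    (hport : ∀ i j u w₁ w₂ w₃ w₄, i ≠ j → w₁ < u → w₂ < u → u < w₃ → u < w₄ →
      (monotoneInstance p hp).usesEdge i w₁ u → (monotoneInstance p hp).usesEdge j w₂ u →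
      (monotoneInstance p hp).usesEdge i u w₃ → (monotoneInstance p hp).usesEdge j u w₄ →
      (w₁ < w₂ ∨ w₁ = w₂ ∧ h i < h j) → (w₃ < w₄ ∨ w₃ = w₄ ∧ h j < h i) → False) :
    CrossingFree lay := by
  have hedge : ∀ i j u v, ¬ EdgeCross lay i j u v := by
    rintro i j u v ⟨-, h1, h2⟩
    rcases lt_trichotomy u v with huv | rfl | huv
    · exact lt_asymm (hlt u v i j huv h1) (hgt v u i j huv h2)
    · exact monotoneInstance_not_usesEdge_self
        ((lay.mem_iff u u i).1 (h1.subset (by simp)))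
    · exact lt_asymm (hgt u v i j huv h1) (hlt v u i j huv h2)
  have halt : ∀ i j u, i ≠ j → ¬ [i, j, i, j].Sublist (cyclicAt lay u) := by
    intro i j u hij hs
    obtain ⟨w1, w2, w3, w4, ⟨h12, h13⟩, ⟨h34, h24⟩, m1, m2, m3, m4⟩ :=
      exists_ports_of_alternating hs
    rw [lay.mem_iff] at m1 m2 m3 m4
    obtain ⟨h1, h3⟩ := monotoneInstance_ports_separated h13 m1 m3
    obtain ⟨h2, h4⟩ := monotoneInstance_ports_separated h24 m2 m4
    exact hport i j u w1 w2 w3 w4 hij h1 h2 h3 h4 (usesEdge_comm.1 m1) (usesEdge_comm.1 m2) m3 m4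
      (h12.imp_right fun h => ⟨h.1, hgt _ _ _ _ h1 h.2⟩)
      (h34.imp_right fun h => ⟨h.1, hlt _ _ _ _ h3 h.2⟩)
  have hvert : ∀ i j u, ¬ VertexCross lay i j u := by
    rintro i j u ⟨hij, k, hs⟩
    rcases alternating_sublist_of_sublist_rotate hs with hs | hs
    · exact halt i j u hij hs
    · exact halt j i u hij.symm hs
  rintro i j - (⟨u, v, h | h⟩ | ⟨u, h | h⟩)
  · exact hedge _ _ _ _ h
  · exact hedge _ _ _ _ h
  · exact hvert _ _ _ h
  · exact hvert _ _ _ h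

theorem CrossingFree.feasible {V : Type} {M : MLCMInstance V ι} {lay : M.Layout}
    (h : CrossingFree lay) : Feasible lay := fun i j u hv =>
  absurd (Or.inr ⟨u, Or.inl hv⟩) (h i j hv.1)

theorem exists_layout_of_height [Finite ι] (h : ι → ℤ) (hinj : Function.Injective h)
    (hport : ∀ i j u w₁ w₂ w₃ w₄, i ≠ j → w₁ < u → w₂ < u → u < w₃ → u < w₄ →
      (monotoneInstance p hp).usesEdge i w₁ u → (monotoneInstance p hp).usesEdge j w₂ u →
      (monotoneInstance p hp).usesEdge i u w₃ → (monotoneInstance p hp).usesEdge j u w₄ →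
      (w₁ < w₂ ∨ w₁ = w₂ ∧ h i < h j) → (w₃ < w₄ ∨ w₃ = w₄ ∧ h j < h i) → False)
    (hper : ∀ a t b u v, (monotoneInstance p hp).usesEdge a u v →
      (monotoneInstance p hp).usesEdge t u v → (monotoneInstance p hp).usesEdge b u v →
      (monotoneInstance p hp).Terminal t u → h a < h t → h t < h b →
      (monotoneInstance p hp).Terminal a u ∨ (monotoneInstance p hp).Terminal b u) :
    ∃ lay : (monotoneInstance p hp).Layout, Feasible lay ∧ Periphery lay ∧ CrossingFree lay := by
  classical
  have := Fintype.ofFinite ι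
  obtain ⟨L, hnd, hmem, hL⟩ : ∃ L : List ι, L.Nodup ∧ (∀ i, i ∈ L) ∧
      L.Pairwise fun i j => h i < h j := by
    have : Std.Total fun a b : ι => h a ≤ h b := ⟨fun a b => le_total _ _⟩
    have : IsTrans ι fun a b : ι => h a ≤ h b := ⟨fun a b c => le_trans⟩
    let L := (Finset.univ : Finset ι).toList.insertionSort fun a b => h a ≤ h b
    have hnd : L.Nodup := (List.perm_insertionSort _ _).nodup_iff.2 (Finset.nodup_toList _)
    refine ⟨L, hnd, fun i => (List.perm_insertionSort _ _).mem_iff.2 (by simp), ?_⟩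
    refine (hnd.and (List.pairwise_insertionSort _ _)).imp ?_
    intro a b hab
    exact lt_of_le_of_ne hab.2 fun e => hab.1 (hinj e)
  let lay : (monotoneInstance p hp).Layout :=
    { ord := fun u v => (if u < v then L.reverse else L).filter
        fun i => decide ((monotoneInstance p hp).usesEdge i u v)
      nodup := fun u v => by
        refine List.Nodup.filter _ ?_
        split
        · exact List.nodup_reverse.2 hnd
        · exact hnd
      mem_iff := fun u v i => by split <;> simp [hmem] }
  have hlt : ∀ u v, u < v → (lay.ord u v).Pairwise fun i j => h j < h i := by
    intro u v huv
    simp only [lay, if_pos huv]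
    exact (List.pairwise_reverse.2 hL).filter _
  have hgt : ∀ u v, ¬ u < v → (lay.ord u v).Pairwise fun i j => h i < h j := by
    intro u v huv
    simp only [lay, if_neg huv]
    exact hL.filter _
  have hcf : CrossingFree lay := crossingFree_of_height h
    (fun u v i j huv hs => by simpa using (hlt u v huv).sublist hs)
    (fun u v i j huv hs => by simpa using (hgt u v (lt_asymm huv)).sublist hs) hport
  refine ⟨lay, hcf.feasible, fun u v => ?_, hcf⟩
  refine exists_mem_outermost_split (fun i => (monotoneInstance p hp).Terminal i u) _ ?_
  intro a t b hs ht
  have ha := (lay.mem_iff u v a).1 (hs.subset (by simp))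
  have ht' := (lay.mem_iff u v t).1 (hs.subset (by simp))
  have hb := (lay.mem_iff u v b).1 (hs.subset (by simp))
  by_cases huv : u < v
  · have := (hlt u v huv).sublist hs
    simp only [List.pairwise_cons, List.mem_cons, forall_eq_or_imp] at this
    exact (hper b t a u v hb ht' ha ht this.2.1.1 this.1.1).symm
  · have := (hgt u v huv).sublist hs
    simp only [List.pairwise_cons, List.mem_cons, forall_eq_or_imp] at this
    exact hper a t b u v ha ht' hb ht this.1.1 this.2.1.1

theorem CrossingFree.no_alternating_ports {lay : (monotoneInstance p hp).Layout}
    (hcf : CrossingFree lay) {i j : ι} (hij : i ≠ j) {u : Fin n} {l : List (Fin n)}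
    (hl : l.Pairwise (· < ·)) (hu : u ∉ l) :
    ¬ [i, j, i, j].Sublist (l.flatMap (lay.ord u)) := by
  intro h
  refine hcf i j hij (Or.inr ⟨u, Or.inl ⟨hij, 0, ?_⟩⟩)
  rw [List.rotate_zero]
  refine h.trans (sublist_flatMap_of_pairwise_lt hl (pairwise_lt_filter_finRange _) ?_ _)
  intro w hw
  simp only [List.mem_filter, List.mem_finRange, true_and, decide_eq_true_eq]
  rintro rfl
  exact hu hw

theorem Periphery.outermost {V : Type} {M : MLCMInstance V ι} {lay : M.Layout}
    (hper : Periphery lay) {u v : V} {a t b : ι} (ht : M.Terminal t u)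
    (ha : ¬ M.Terminal a u) (hb : ¬ M.Terminal b u)
    (hat : [a, t].Sublist (lay.ord u v)) (htb : [t, b].Sublist (lay.ord u v)) : False := by
  obtain ⟨s₁, s₂, s₃, hs, h1, h2, h3⟩ := hper u v
  have hnd := lay.nodup u v
  have hmid : ∀ x ∈ lay.ord u v, ¬ M.Terminal x u → x ∈ s₂ := by
    intro x hx hxT
    simp only [hs, List.mem_append] at hx
    rcases hx with (hx | hx) | hx
    · exact absurd (h1 x hx) hxT
    · exact hx
    · exact absurd (h3 x hx) hxT
  have ha2 := hmid a (hat.subset (by simp)) ha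
  have hb2 := hmid b (htb.subset (by simp)) hb
  have ht' : t ∈ lay.ord u v := hat.subset (by simp)
  rw [hs] at hat htb hnd
  simp only [hs, List.mem_append] at ht'
  rcases ht' with (ht' | ht') | ht'
  · refine not_sublist_swap_of_nodup hnd hat (List.Sublist.trans ?_ (List.sublist_append_left _ _))
    exact (List.singleton_sublist.2 ht').append (List.singleton_sublist.2 ha2)
  · exact h2 t ht' ht
  · refine not_sublist_swap_of_nodup hnd htb ?_
    rw [List.append_assoc]
    refine List.Sublist.trans ?_ (List.sublist_append_right _ _)
    exact (List.singleton_sublist.2 hb2).append (List.singleton_sublist.2 ht')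

end Monotone

/-- Vertex `v` lies on line `i` of the obstruction with `m + 1` lines. Line `m` runs along the
spine `2, …, m + 3` with a private edge at both ends. Each line `i < m` occupies the spine
vertices `i + 2, i + 3, i + 4`, except that line `0` starts at vertex `1` and line `m - 1` ends
beyond the spine, leaving it on a side of line `m` that depends on the parity of `m`. -/
def zigzagLine (m i v : ℕ) : Prop :=
  (i = m ∧ (v = 0 ∨ (2 ≤ v ∧ v ≤ m + 3) ∨ v = m + 5 - m % 2)) ∨
  (i < m ∧ ((i + 2 ≤ v ∧ v ≤ i + 4 ∧ v ≤ m + 3) ∨ (i = 0 ∧ v = 1) ∨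
    (i + 1 = m ∧ v = m + 4 + m % 2)))

/-- The edges `u < v` of line `i`. -/
def zigzagEdge (m i u v : ℕ) : Prop :=
  (i = m ∧ ((u = 0 ∧ v = 2) ∨ (2 ≤ u ∧ v = u + 1 ∧ v ≤ m + 3) ∨
    (u = m + 3 ∧ v = m + 5 - m % 2))) ∨
  (i < m ∧ ((i + 2 ≤ u ∧ u ≤ i + 3 ∧ v = u + 1 ∧ v ≤ m + 3) ∨ (i = 0 ∧ u = 1 ∧ v = 2) ∨
    (i + 1 = m ∧ u = m + 3 ∧ v = m + 4 + m % 2)))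

theorem zigzagEdge_iff {m i u v : ℕ} (hm : 1 ≤ m) :
    (zigzagLine m i u ∧ zigzagLine m i v ∧
      ∀ w < m + 6, zigzagLine m i w → u < w → ¬ w < v) ∧ u < v ↔ zigzagEdge m i u v := by
  constructor
  · rintro ⟨⟨h1, h2, h3⟩, h4⟩
    by_cases hi : i = m
    · subst hi
      have a1 := h3 2 (by omega) (by unfold zigzagLine; omega)
      have a2 := h3 (i + 3) (by omega) (by unfold zigzagLine; omega)
      have a3 : 2 ≤ u → u ≤ i + 2 → ¬ u + 1 < v := fun _ _ =>
        h3 (u + 1) (by omega) (by unfold zigzagLine; omega) (by omega)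
      clear h3
      simp only [zigzagLine, zigzagEdge, true_and, lt_irrefl, false_and, or_false] at *
      omega
    · have hi' : i < m := by
        unfold zigzagLine at h1; omega
      have a1 := h3 (i + 2) (by omega) (by unfold zigzagLine; omega)
      have a2 := fun h : i + 1 = m => h3 (m + 3) (by omega) (by unfold zigzagLine; omega)
      have a3 : i + 2 ≤ u → u ≤ i + 3 → u ≤ m + 2 → ¬ u + 1 < v := fun _ _ _ =>
        h3 (u + 1) (by omega) (by unfold zigzagLine; omega) (by omega)
      clear h3
      simp only [zigzagLine, zigzagEdge, hi, hi', true_and, false_and, false_or] at *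
      omega
  · intro h
    unfold zigzagEdge at h
    unfold zigzagLine
    refine ⟨⟨by omega, by omega, fun w => by omega⟩, by omega⟩

open Classical in
/-- The incidence predicate of the obstruction, as a Boolean function. -/
noncomputable def zigzag (m : ℕ) (i : Fin (m + 1)) (v : Fin (m + 6)) : Bool :=
  decide (zigzagLine m i v)

theorem zigzag_iff {m : ℕ} {i : Fin (m + 1)} {v : Fin (m + 6)} :
    zigzag m i v = true ↔ zigzagLine m i v := by simp [zigzag]

theorem two_le_length_zigzag {m : ℕ} (i : Fin (m + 1)) :
    2 ≤ ((List.finRange (m + 6)).filter (zigzag m i)).length := by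
  have hi := i.isLt
  have key : ∀ a b : Fin (m + 6), a.val < b.val → zigzag m i a → zigzag m i b →
      2 ≤ ((List.finRange (m + 6)).filter (zigzag m i)).length := by
    intro a b hab ha hb
    have hsub : [a, b] ⊆ (List.finRange (m + 6)).filter (zigzag m i) := by simp [ha, hb]
    have hnd : [a, b].Nodup := by simpa using Fin.ne_of_lt hab
    exact (hnd.subperm hsub).length_le
  by_cases h : i.val = m
  · refine key ⟨2, by omega⟩ ⟨3, by omega⟩ (by simp) ?_ ?_ <;>
      rw [zigzag_iff] <;> simp only [zigzagLine] <;> omega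
  · refine key ⟨i + 2, by omega⟩ ⟨i + 3, by omega⟩ (by simp) ?_ ?_ <;>
      rw [zigzag_iff] <;> simp only [zigzagLine] <;> omega

section Zigzag

variable {m : ℕ} {ι : Type} {f : ι → Fin (m + 1)}

/-- The subinstance (or reindexing) of the obstruction with lines `f k`. -/
noncomputable abbrev zigzagInstance (f : ι → Fin (m + 1)) : MLCMInstance (Fin (m + 6)) ι :=
  monotoneInstance (fun k => zigzag m (f k)) fun k => two_le_length_zigzag (f k)

theorem zigzagInstance_usesEdge_iff (hm : 1 ≤ m) {i : ι} {u v : Fin (m + 6)} (huv : u < v) :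
    (zigzagInstance f).usesEdge i u v ↔ zigzagEdge m (f i) u v := by
  rw [monotoneInstance_usesEdge_of_lt huv, ← zigzagEdge_iff hm]
  simp only [zigzag_iff, Fin.lt_def, Fin.forall_iff] at huv ⊢
  tauto

theorem zigzagInstance_terminal_iff {i : ι} {u : Fin (m + 6)} :
    (zigzagInstance f).Terminal i u ↔ zigzagLine m (f i) u ∧
      ((∀ w < m + 6, zigzagLine m (f i) w → u ≤ w) ∨
        ∀ w < m + 6, zigzagLine m (f i) w → w ≤ u) := by
  rw [monotoneInstance_terminal]
  simp only [zigzag_iff, Fin.le_def, Fin.forall_iff]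

theorem zigzagInstance_exists_layout (hm : 1 ≤ m) [Finite ι] (hf : Function.Injective f)
    (hsurj : ¬ Function.Surjective f) :
    ∃ lay : (zigzagInstance f).Layout, Feasible lay ∧ Periphery lay ∧ CrossingFree lay := by
  obtain ⟨j₀, hj₀⟩ : ∃ j₀, ∀ k, f k ≠ j₀ := by
    simpa [Function.Surjective] using hsurj
  let g : ℕ → ℤ := fun i => if i = m then 0 else
    if (i < j₀.val ↔ i % 2 = 0) then (i + 1 : ℤ) else -(i + 1 : ℤ)
  have hg : ∀ i, i = m ∧ g i = 0 ∨ i ≠ m ∧ (i < j₀.val ↔ i % 2 = 0) ∧ g i = i + 1 ∨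
      i ≠ m ∧ ¬ (i < j₀.val ↔ i % 2 = 0) ∧ g i = -(i + 1) := by
    intro i
    simp only [g]
    split_ifs <;> simp_all
  have hlt : ∀ k, (f k).val < m + 1 := fun k => (f k).isLt
  have hne : ∀ k, (f k).val ≠ j₀.val := fun k h => hj₀ k (Fin.ext h)
  have hj := j₀.isLt
  refine exists_layout_of_height (fun k => g (f k)) ?_ ?_ ?_
  · intro a b hab
    apply hf
    apply Fin.ext
    have h1 := hg (f a)
    have h2 := hg (f b)
    simp only at hab
    omega
  · intro i j u w1 w2 w3 w4 hij h1 h2 h3 h4 e1 e2 e3 e4 h12 h34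
    rw [zigzagInstance_usesEdge_iff hm ‹_›] at e1 e2 e3 e4
    have hij' : (f i).val ≠ (f j).val := fun h => hij (hf (Fin.ext h))
    simp only [Fin.lt_def, Fin.ext_iff] at *
    have hi := hg (f i)
    have hj' := hg (f j)
    have := hlt i
    have := hlt j
    have := hne i
    have := hne j
    have hu : 2 ≤ u.val ∧ u.val ≤ m + 3 := by
      refine ⟨?_, ?_⟩
      · clear e2 e3 e4 h12 h34 hg hi hj'
        unfold zigzagEdge at e1
        omega
      · clear e1 e2 e4 h12 h34 hg hi hj'
        unfold zigzagEdge at e3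
        omega
    have hleft : ∀ k w, zigzagEdge m k w u → u.val = 2 ∧ (k = m ∧ w = 0 ∨ k = 0 ∧ w = 1) ∨
        3 ≤ u.val ∧ u.val = w + 1 := by
      intro k w he
      clear e1 e2 e3 e4 h12 h34 hg hi hj'
      unfold zigzagEdge at he
      omega
    have hright : ∀ k w, zigzagEdge m k u w → u.val = m + 3 ∧
        (k = m ∧ w = m + 5 - m % 2 ∨ k + 1 = m ∧ w = m + 4 + m % 2) ∨
        u.val < m + 3 ∧ w = u.val + 1 := by
      intro k w he
      clear e1 e2 e3 e4 h12 h34 hg hi hj' hleft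
      unfold zigzagEdge at he
      omega
    have l1 := hleft _ _ e1
    have l2 := hleft _ _ e2
    have r1 := hright _ _ e3
    have r2 := hright _ _ e4
    clear e1 e2 e3 e4 hg hleft hright
    rcases h12 with h12 | h12 <;> rcases h34 with h34 | h34 <;> omega
  · intro a t b u v ea et eb ht hat htb
    exfalso
    have key : ∀ x y : Fin (m + 6), x < y → (zigzagInstance f).usesEdge a x y →
        (zigzagInstance f).usesEdge t x y → (zigzagInstance f).usesEdge b x y →
        (f t).val = m ∧ x.val ≠ 0 ∧ y.val ≤ m + 3 := by
      intro x y hxy ea et eb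
      rw [Fin.lt_def] at hxy
      have hclass : ∀ k, (zigzagInstance f).usesEdge k x y →
          (f k).val = m ∧ g (f k) = 0 ∨ (x.val = 1 ∧ (f k).val = 0 ∨
            x.val = m + 3 ∧ (f k).val + 1 = m ∨ 2 ≤ x.val ∧ y.val ≤ m + 3 ∧
              ((f k).val + 2 = x.val ∨ (f k).val + 3 = x.val)) ∧ (f k).val < m := by
        intro k hk
        rw [zigzagInstance_usesEdge_iff hm hxy] at hk
        have := hg (f k)
        unfold zigzagEdge at hk
        omega
      have ca := hclass a ea
      have ct := hclass t et
      have cb := hclass b eb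
      have h1 := hg (f a)
      have h2 := hg (f t)
      have h3 := hg (f b)
      have := hne a
      have := hne t
      have := hne b
      clear hclass hg ea et eb
      rcases ca with ca | ca <;> rcases ct with ct | ct <;> rcases cb with cb | cb <;> omega
    rw [zigzagInstance_terminal_iff] at ht
    obtain ⟨hu, hu'⟩ := ht
    have h3 : ∀ z, z = 0 ∨ z = m + 5 - m % 2 → zigzagLine m m z := fun z hz => by
      unfold zigzagLine; omega
    have hle : (f t).val = m → u.val ≠ 0 → u.val ≤ m + 3 → False := by
      intro htm h0 h1
      rw [htm] at hu'
      rcases hu' with hu' | hu'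
      · have := hu' 0 (by omega) (h3 _ (by omega))
        omega
      · have := hu' (m + 5 - m % 2) (by omega) (h3 _ (by omega))
        omega
    rcases lt_trichotomy u v with huv | rfl | huv
    · obtain ⟨k1, k2, k3⟩ := key u v huv ea et eb
      exact hle k1 k2 (by rw [Fin.lt_def] at huv; omega)
    · exact monotoneInstance_not_usesEdge_self ea
    · obtain ⟨k1, k2, k3⟩ := key v u huv (usesEdge_comm.1 ea) (usesEdge_comm.1 et)
        (usesEdge_comm.1 eb)
      exact hle k1 (by rw [Fin.lt_def] at huv; omega) k3

theorem zigzagInstance_no_layout (hm : 1 ≤ m) (lay : (zigzagInstance (id : Fin (m + 1) → _)).Layout)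
    (hper : Periphery lay) (hcf : CrossingFree lay) : False := by
  let V : ℕ → Fin (m + 6) := fun x => Fin.ofNat _ x
  let Λ : ℕ → Fin (m + 1) := fun a => Fin.ofNat _ a
  have hV : ∀ x, x < m + 6 → (V x).val = x := fun x hx => Nat.mod_eq_of_lt hx
  have hΛ : ∀ a, a < m + 1 → (Λ a).val = a := fun a ha => Nat.mod_eq_of_lt ha
  have hVlt : ∀ x y, x < y → y < m + 6 → V x < V y := fun x y hxy hy => by
    rw [Fin.lt_def, hV x (by omega), hV y hy]; exact hxy
  have hΛne : ∀ a b, a ≠ b → a < m + 1 → b < m + 1 → Λ a ≠ Λ b := fun a b hab ha hb h => hab (by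
    rw [← hΛ a ha, ← hΛ b hb, h])
  let B : ℕ → ℕ → ℕ → ℕ → Prop := fun x y a b => [Λ a, Λ b].Sublist (lay.ord (V x) (V y))
  have hmem : ∀ a x y, a < m + 1 → x < y → y < m + 6 → zigzagEdge m a x y →
      Λ a ∈ lay.ord (V x) (V y) ∧ Λ a ∈ lay.ord (V y) (V x) := by
    intro a x y ha hxy hy he
    rw [lay.mem_iff, lay.mem_iff, usesEdge_comm (u := V y), and_self,
      zigzagInstance_usesEdge_iff hm (hVlt x y hxy hy), hV x (by omega), hV y hy, id, hΛ a ha]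
    exact he
  have htot : ∀ a b x y, a ≠ b → a < m + 1 → b < m + 1 → x < y → y < m + 6 → zigzagEdge m a x y →
      zigzagEdge m b x y → (B x y a b ∨ B x y b a) ∧ (B y x a b ∨ B y x b a) := by
    intro a b x y hab ha hb hxy hy hae hbe
    obtain ⟨h1, h2⟩ := hmem a x y ha hxy hy hae
    obtain ⟨h3, h4⟩ := hmem b x y hb hxy hy hbe
    exact ⟨(eq_or_sublist_pair h1 h3).resolve_left (hΛne a b hab ha hb),
      (eq_or_sublist_pair h2 h4).resolve_left (hΛne a b hab ha hb)⟩
  have hedge : ∀ a b x y, a ≠ b → a < m + 1 → b < m + 1 → B x y a b → ¬ B y x a b := by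
    intro a b x y hab ha hb h1 h2
    exact hcf _ _ (hΛne a b hab ha hb) (Or.inl ⟨_, _, Or.inl ⟨hΛne a b hab ha hb, h1, h2⟩⟩)
  have hflip : ∀ a b x y, a ≠ b → a < m + 1 → b < m + 1 → x < y → y < m + 6 →
      zigzagEdge m a x y → zigzagEdge m b x y → (B x y a b ↔ B y x b a) := by
    intro a b x y hab ha hb hxy hy hae hbe
    have h := htot a b x y hab ha hb hxy hy hae hbe
    exact ⟨fun h1 => h.2.resolve_left (hedge a b x y hab ha hb h1),
      fun h1 => h.1.resolve_right fun h2 => hedge b a x y hab.symm hb ha h2 h1⟩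
  have hpass : ∀ a b x, a ≠ b → a < m + 1 → b < m + 1 → x + 2 < m + 6 →
      zigzagEdge m a x (x + 1) → zigzagEdge m b x (x + 1) →
      zigzagEdge m a (x + 1) (x + 2) → zigzagEdge m b (x + 1) (x + 2) →
      B x (x + 1) a b → B (x + 1) (x + 2) a b := by
    intro a b x hab ha hb hx h1 h2 h3 h4 h
    refine (htot a b (x + 1) (x + 2) hab ha hb (by omega) hx h3 h4).1.resolve_right fun h' => ?_
    have h'' := (hflip a b x (x + 1) hab ha hb (by omega) (by omega) h1 h2).1 h
    have l1 := hVlt x (x + 1) (by omega) (by omega)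
    have l2 := hVlt (x + 1) (x + 2) (by omega) (by omega)
    refine hcf.no_alternating_ports (hΛne b a hab.symm hb ha) (u := V (x + 1))
      (l := [V x, V (x + 2)]) (by simpa using l1.trans l2) (by simp [l1.ne', l2.ne]) ?_
    simpa using List.Sublist.append h'' h'
  have hterm : ∀ a x, a < m + 1 → x < m + 6 → ((zigzagInstance id).Terminal (Λ a) (V x) ↔
      zigzagLine m a x ∧ ((∀ w < m + 6, zigzagLine m a w → x ≤ w) ∨
        ∀ w < m + 6, zigzagLine m a w → w ≤ x)) := by
    intro a x ha hx
    rw [zigzagInstance_terminal_iff, hV x hx, id, hΛ a ha]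
  have hmid : ∀ a x, a < m + 1 → 3 ≤ x → x ≤ m + 2 → a = m ∨ x = a + 3 →
      ¬ (zigzagInstance id).Terminal (Λ a) (V x) := by
    intro a x ha h1 h2 h3 hT
    rw [hterm a x ha (by omega)] at hT
    rcases hT with ⟨-, hT | hT⟩
    · have := hT (x - 1) (by omega) (by unfold zigzagLine; omega)
      omega
    · have := hT (x + 1) (by omega) (by unfold zigzagLine; omega)
      omega
  have hend : ∀ a, a + 1 < m → (zigzagInstance id).Terminal (Λ a) (V (a + 4)) ∧
      (zigzagInstance id).Terminal (Λ (a + 1)) (V (a + 3)) := by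
    intro a ha
    rw [hterm a _ (by omega) (by omega), hterm (a + 1) _ (by omega) (by omega)]
    refine ⟨⟨by unfold zigzagLine; omega, Or.inr fun w _ => ?_⟩,
      ⟨by unfold zigzagLine; omega, Or.inl fun w _ => ?_⟩⟩ <;>
    · unfold zigzagLine; omega
  have hstep : ∀ i, i + 1 < m →
      (B (i + 2) (i + 3) i m → B (i + 3) (i + 4) m (i + 1)) ∧
      (B (i + 2) (i + 3) m i → B (i + 3) (i + 4) (i + 1) m) := by
    intro i hi
    have e1 : zigzagEdge m i (i + 2) (i + 3) := by unfold zigzagEdge; omega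
    have e2 : zigzagEdge m i (i + 3) (i + 4) := by unfold zigzagEdge; omega
    have e3 : zigzagEdge m (i + 1) (i + 3) (i + 4) := by unfold zigzagEdge; omega
    have e4 : zigzagEdge m m (i + 2) (i + 3) := by unfold zigzagEdge; omega
    have e5 : zigzagEdge m m (i + 3) (i + 4) := by unfold zigzagEdge; omega
    have t1 := htot i (i + 1) (i + 3) (i + 4) (by omega) (by omega) (by omega) (by omega)
      (by omega) e2 e3
    have t2 := htot m (i + 1) (i + 3) (i + 4) (by omega) (by omega) (by omega) (by omega)
      (by omega) e5 e3
    have f1 := hflip i m (i + 3) (i + 4) (by omega) (by omega) (by omega) (by omega) (by omega)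
      e2 e5
    have f1' := hflip m i (i + 3) (i + 4) (by omega) (by omega) (by omega) (by omega) (by omega)
      e5 e2
    have f2 := hflip i (i + 1) (i + 3) (i + 4) (by omega) (by omega) (by omega) (by omega)
      (by omega) e2 e3
    have f2' := hflip (i + 1) i (i + 3) (i + 4) (by omega) (by omega) (by omega) (by omega)
      (by omega) e3 e2
    obtain ⟨T1, T2⟩ := hend i hi
    have N1 := hmid m (i + 4) (by omega) (by omega) (by omega) (by omega)
    have N2 := hmid (i + 1) (i + 4) (by omega) (by omega) (by omega) (by omega)
    have N3 := hmid m (i + 3) (by omega) (by omega) (by omega) (by omega)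
    have N4 := hmid i (i + 3) (by omega) (by omega) (by omega) (by omega)
    constructor
    · intro h
      have h1 := hpass i m (i + 2) (by omega) (by omega) (by omega) (by omega) e1 e4 e2 e5 h
      have h2 : B (i + 4) (i + 3) (i + 1) i :=
        (t1.2).resolve_left fun h' => hper.outermost T1 N1 N2 (f1.1 h1) h'
      exact t2.1.resolve_right fun h' => hper.outermost T2 N4 N3 (f2.2 h2) h'
    · intro h
      have h1 := hpass m i (i + 2) (by omega) (by omega) (by omega) (by omega) e4 e1 e5 e2 h
      have h2 : B (i + 4) (i + 3) i (i + 1) :=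
        (t1.2).resolve_right fun h' => hper.outermost T1 N2 N1 h' (f1'.1 h1)
      exact t2.1.resolve_left fun h' => hper.outermost T2 N3 N4 h' (f2'.2 h2)
  have hbase : B 2 3 0 m := by
    have e1 : zigzagEdge m 0 2 3 := by unfold zigzagEdge; omega
    have e2 : zigzagEdge m m 2 3 := by unfold zigzagEdge; omega
    refine (htot 0 m 2 3 (by omega) (by omega) (by omega) (by omega) (by omega)
      e1 e2).1.resolve_right fun h => ?_
    have m1 := (hmem m 0 2 (by omega) (by omega) (by omega) (by unfold zigzagEdge; omega)).2
    have m2 := (hmem 0 1 2 (by omega) (by omega) (by omega) (by unfold zigzagEdge; omega)).2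
    have l1 := hVlt 0 1 (by omega) (by omega)
    have l2 := hVlt 1 2 (by omega) (by omega)
    have l3 := hVlt 2 3 (by omega) (by omega)
    refine hcf.no_alternating_ports (hΛne m 0 (by omega) (by omega) (by omega)) (u := V 2)
      (l := [V 0, V 1, V 3])
      (by simpa using ⟨⟨l1, l1.trans (l2.trans l3)⟩, l2.trans l3⟩)
      (by simp [(l1.trans l2).ne', l2.ne', l3.ne]) ?_
    simpa using (List.singleton_sublist.2 m1).append ((List.singleton_sublist.2 m2).append h)
  have hall : ∀ i, i < m → (i % 2 = 0 → B (i + 2) (i + 3) i m) ∧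
      (i % 2 = 1 → B (i + 2) (i + 3) m i) := by
    intro i
    induction i with
    | zero => exact fun _ => ⟨fun _ => hbase, fun h => absurd h (by omega)⟩
    | succ i ih =>
      intro hi
      obtain ⟨h1, h2⟩ := ih (by omega)
      exact ⟨fun h => (hstep i hi).2 (h2 (by omega)), fun h => (hstep i hi).1 (h1 (by omega))⟩
  obtain ⟨r, rfl⟩ : ∃ r, m = r + 1 := ⟨m - 1, by omega⟩
  have e1 : zigzagEdge (r + 1) r (r + 2) (r + 3) := by unfold zigzagEdge; omega
  have e2 : zigzagEdge (r + 1) r (r + 3) (r + 4) := by unfold zigzagEdge; omega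
  have e3 : zigzagEdge (r + 1) (r + 1) (r + 2) (r + 3) := by unfold zigzagEdge; omega
  have e4 : zigzagEdge (r + 1) (r + 1) (r + 3) (r + 4) := by unfold zigzagEdge; omega
  have l1 := hVlt (r + 3) (r + 4) (by omega) (by omega)
  have l2 := hVlt (r + 4) (r + 5) (by omega) (by omega)
  have l3 := hVlt (r + 5) (r + 6) (by omega) (by omega)
  have hcross : ∀ a b, a ≠ b → a < r + 1 + 1 → b < r + 1 + 1 → B (r + 4) (r + 3) a b →
      zigzagEdge (r + 1) a (r + 4) (r + 5) → zigzagEdge (r + 1) b (r + 4) (r + 6) → False := by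
    intro a b hab ha hb h ea eb
    have m1 := (hmem a _ _ ha (by omega) (by omega) ea).1
    have m2 := (hmem b _ _ hb (by omega) (by omega) eb).1
    refine hcf.no_alternating_ports (hΛne a b hab ha hb) (u := V (r + 4))
      (l := [V (r + 3), V (r + 5), V (r + 6)])
      (by simpa using ⟨⟨l1.trans l2, l1.trans (l2.trans l3)⟩, l3⟩)
      (by simp [l1.ne', l2.ne, (l2.trans l3).ne]) ?_
    simpa using h.append ((List.singleton_sublist.2 m1).append (List.singleton_sublist.2 m2))
  have hflip' := hflip r (r + 1) (r + 3) (r + 4) (by omega) (by omega) (by omega) (by omega)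
    (by omega) e2 e4
  have hflip'' := hflip (r + 1) r (r + 3) (r + 4) (by omega) (by omega) (by omega) (by omega)
    (by omega) e4 e2
  rcases Nat.mod_two_eq_zero_or_one r with hr | hr
  · have h := hpass r (r + 1) (r + 2) (by omega) (by omega) (by omega) (by omega) e1 e3 e2 e4
      ((hall r (by omega)).1 hr)
    exact hcross (r + 1) r (by omega) (by omega) (by omega) (hflip'.1 h)
      (by unfold zigzagEdge; omega) (by unfold zigzagEdge; omega)
  · have h := hpass (r + 1) r (r + 2) (by omega) (by omega) (by omega) (by omega) e3 e1 e4 e2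
      ((hall r (by omega)).2 hr)
    exact hcross r (r + 1) (by omega) (by omega) (by omega) (hflip''.1 h)
      (by unfold zigzagEdge; omega) (by unfold zigzagEdge; omega)

end Zigzag

end MLCMInstance

open MLCMInstance in
/-- For every `k ≥ 2` there exists an instance `(G, L)` of
MLCM-P with `|L| = k` lines such that for every proper subset `L' ⊊ L` the
instance `(G, L')` admits a crossing-free solution, while `(G, L)` itself
admits no crossing-free solution. -/
theorem mlcmp_no_small_obstruction_for_crossing_free
    (k : ℕ) (hk : 2 ≤ k) :
    ∃ (V ι : Type) (_ : Fintype V) (_ : Fintype ι) (M : MLCMInstance V ι),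
      Nat.card ι = k ∧
      (∀ s : Set ι, s ≠ Set.univ →
        ∃ lay : (M.restrictLines s).Layout,
          Feasible lay ∧ Periphery lay ∧ CrossingFree lay) ∧
      ¬ ∃ lay : M.Layout, Feasible lay ∧ Periphery lay ∧ CrossingFree lay := by
  obtain ⟨m, rfl⟩ : ∃ m, k = m + 1 := ⟨k - 1, by omega⟩
  have hm : 1 ≤ m := by omega
  refine ⟨Fin (m + 6), Fin (m + 1), inferInstance, inferInstance,
    zigzagInstance id, by simp, ?_, ?_⟩
  · intro s hs
    refine zigzagInstance_exists_layout (f := ((↑) : s → Fin (m + 1))) hm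
      Subtype.val_injective fun h => hs ?_
    rwa [← Set.range_eq_univ, Subtype.range_coe] at h
  · rintro ⟨lay, -, hper, hcf⟩
    exact zigzagInstance_no_layout hm lay hper hcf
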